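/- Let I ⊆ Π be μ-connected and suppose every connected component of I ∩ J₀ is of finite type. Then F_I ∩ C̄ = (μ − ℝ₊I) ∩ C̄ = (μ − ℝ₊I) ∩ C̄_{I_*}. -/

import Mathlib

open Set Module

noncomputable section

/-- The linear reflection `x ↦ x - f x • a` associated to a vector `a` and a linear
functional `f` with `f a = 2`, bundled as a linear automorphism. -/
def reflEquiv {V : Type*} [AddCommGroup V] [Module ℝ V]
    (a : V) (f : V →ₗ[ℝ] ℝ) (h2 : f a = 2) : V ≃ₗ[ℝ] V :=
  LinearEquiv.ofInvolutive (LinearMap.id - f.smulRight a)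
    (fun x => by
      simp only [LinearMap.sub_apply, LinearMap.id_apply, LinearMap.smulRight_apply,
        map_sub, map_smul, smul_eq_mul, h2]
      module)

/-- A realization over `ℝ` of an `m × m` generalized Cartan matrix `A`:
simple roots `α_i`, simple coroots `α_i∨` (as linear functionals), with
`⟨α_j, α_i∨⟩ = a_{ij}`, together with the defining axioms. -/
structure GCMRealization (m : ℕ) (V : Type*) [NormedAddCommGroup V] [NormedSpace ℝ V] where
  A : Matrix (Fin m) (Fin m) ℤ
  root : Fin m → V
  coroot : Fin m → V →ₗ[ℝ] ℝ
  one_le_m : 1 ≤ m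
  A_diag : ∀ i, A i i = 2
  A_offdiag : ∀ i j, i ≠ j → A i j ≤ 0
  A_zero_iff : ∀ i j, A i j = 0 ↔ A j i = 0
  root_indep : LinearIndependent ℝ root
  coroot_indep : LinearIndependent ℝ coroot
  pairing : ∀ i j, coroot i (root j) = (A i j : ℝ)
  finDim : FiniteDimensional ℝ V
  dim_eq : finrank ℝ V + (A.map ((↑) : ℤ → ℝ)).rank = 2 * m

/-- A face of a convex set `H`: a convex subset `F ⊆ H` such that whenever the open
segment between two points of `H` meets `F`, both points lie in `F`. -/
def IsFaceOf {V : Type*} [NormedAddCommGroup V] [NormedSpace ℝ V] (H F : Set V) : Prop :=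
  Convex ℝ F ∧ IsExtreme ℝ H F

namespace GCMRealization

variable {m : ℕ} {V : Type*} [NormedAddCommGroup V] [NormedSpace ℝ V]
variable (S : GCMRealization m V)

/-- The fundamental reflection `r_i`. -/
def s (i : Fin m) : V ≃ₗ[ℝ] V :=
  reflEquiv (S.root i) (S.coroot i) (by
    have h := S.pairing i i
    rw [S.A_diag i] at h
    simpa using h)

/-- The Weyl group `W`, as a subgroup of the group of linear automorphisms of `V`. -/
def W : Subgroup (V ≃ₗ[ℝ] V) := Subgroup.closure (Set.range S.s)

/-- The standard parabolic subgroup `W_I` generated by the reflections indexed by `I`. -/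
def WI (I : Set (Fin m)) : Subgroup (V ≃ₗ[ℝ] V) := Subgroup.closure (S.s '' I)

/-- The closed fundamental chamber `C̄`. -/
def chamber : Set V := {η | ∀ i, 0 ≤ S.coroot i η}

/-- `J₀`: the set of indices `i` with `⟨μ, α_i∨⟩ = 0`. -/
def J0 (μ : V) : Set (Fin m) := {i | S.coroot i μ = 0}

/-- The orbit of `μ` under a subgroup of linear automorphisms. -/
def orbitOf (G : Subgroup (V ≃ₗ[ℝ] V)) (μ : V) : Set V :=
  (fun w : V ≃ₗ[ℝ] V => w μ) '' (G : Set (V ≃ₗ[ℝ] V))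

/-- `F_I`: the convex hull of `W_I · μ`. -/
def face (μ : V) (I : Set (Fin m)) : Set V := convexHull ℝ (orbitOf (S.WI I) μ)

/-- `H`: the convex hull of the Weyl group orbit of `μ`. -/
def orbitHull (μ : V) : Set V := convexHull ℝ (orbitOf S.W μ)

/-- `ℝ₊I`: the set of nonnegative linear combinations of the simple roots indexed by `I`. -/
def coneNonneg (I : Set (Fin m)) : Set V :=
  {v | ∃ c : Fin m → ℝ, (∀ i, 0 ≤ c i) ∧ (∀ i, i ∉ I → c i = 0) ∧ v = ∑ i, c i • S.root i}

/-- `ℝ_>I`: the set of strictly positive linear combinations of the simple roots indexed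
by `I` (with `ℝ_>∅ = {0}`). -/
def conePos (I : Set (Fin m)) : Set V :=
  {v | ∃ c : Fin m → ℝ, (∀ i ∈ I, 0 < c i) ∧ (∀ i, i ∉ I → c i = 0) ∧ v = ∑ i, c i • S.root i}

/-- The open standard facet `C_J`. -/
def openFacet (J : Set (Fin m)) : Set V :=
  {η | (∀ i ∈ J, S.coroot i η = 0) ∧ ∀ i, i ∉ J → 0 < S.coroot i η}

/-- The closed standard facet `C̄_J`. -/
def closedFacet (J : Set (Fin m)) : Set V :=
  {η | (∀ i ∈ J, S.coroot i η = 0) ∧ ∀ i, i ∉ J → 0 ≤ S.coroot i η}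

/-- Adjacency of two vertices of the Dynkin diagram: `i ≠ j` and `a_{ij} ≠ 0`
(equivalently `a_{ji} ≠ 0`). -/
def Adjacent (i j : Fin m) : Prop := i ≠ j ∧ S.A i j ≠ 0 ∧ S.A j i ≠ 0

/-- The Dynkin diagram, as a simple graph on the index set. -/
def diagram : SimpleGraph (Fin m) where
  Adj := S.Adjacent
  symm := ⟨fun _ _ h => ⟨h.1.symm, h.2.2, h.2.1⟩⟩
  loopless := ⟨fun _ h => h.1 rfl⟩

/-- A subset `I` is `μ`-connected if every connected component of `I` meets
`J_> = Π \ J₀` (the empty set is `μ`-connected). -/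
def MuConnected (μ : V) (I : Set (Fin m)) : Prop :=
  ∀ i : I, ∃ j : I, S.coroot (j : Fin m) μ ≠ 0 ∧ (S.diagram.induce I).Reachable i j

/-- The connected component of `i` inside `K`, as a subset of the index set. -/
def comp (K : Set (Fin m)) (i : Fin m) : Set (Fin m) :=
  {j | ∃ (hi : i ∈ K) (hj : j ∈ K), (S.diagram.induce K).Reachable ⟨i, hi⟩ ⟨j, hj⟩}

/-- `I*`: the largest `μ`-connected subset of `I`, i.e. the union of the connected
components of `I` that meet `J_>`. -/
def muPart (μ : V) (I : Set (Fin m)) : Set (Fin m) :=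
  {j | ∃ (hj : j ∈ I) (k : Fin m) (hk : k ∈ I), S.coroot k μ ≠ 0 ∧
    (S.diagram.induce I).Reachable ⟨j, hj⟩ ⟨k, hk⟩}

/-- `I_*`: the set of `α ∈ J₀ \ I` orthogonal to all of `I`. -/
def starSet (μ : V) (I : Set (Fin m)) : Set (Fin m) :=
  {i | S.coroot i μ = 0 ∧ i ∉ I ∧ ∀ j ∈ I, S.coroot i (S.root j) = 0}

/-- A subset `K ⊆ Π` is of finite type if the subgroup `W_K` is finite. -/
def FiniteType (K : Set (Fin m)) : Prop := ((S.WI K : Subgroup (V ≃ₗ[ℝ] V)) : Set (V ≃ₗ[ℝ] V)).Finite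

/-- Every connected component of `K` is of finite type. -/
def FinTypeComponents (K : Set (Fin m)) : Prop := ∀ i ∈ K, S.FiniteType (S.comp K i)

/-- A fundamental face of `H`: a face which is empty or whose relative interior meets
the fundamental chamber. -/
def IsFundFace (μ : V) (F : Set V) : Prop :=
  IsFaceOf (S.orbitHull μ) F ∧ (F = ∅ ∨ (intrinsicInterior ℝ F ∩ S.chamber).Nonempty)

/-- The length of `w ∈ W` with respect to the fundamental reflections. -/
def len (w : V ≃ₗ[ℝ] V) : ℕ :=
  sInf {k | ∃ l : List (Fin m), l.length = k ∧ w = (l.map S.s).prod}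

end GCMRealization

end


namespace GCMRealization

section Aux

variable {m : ℕ} {V : Type*} [NormedAddCommGroup V] [NormedSpace ℝ V]
variable (S : GCMRealization m V)

theorem s_apply (i : Fin m) (v : V) : S.s i v = v - S.coroot i v • S.root i := by
  rfl

theorem co_self (i : Fin m) : S.coroot i (S.root i) = 2 := by
  rw [S.pairing, S.A_diag]; norm_num

theorem s_mul_self (i : Fin m) : S.s i * S.s i = 1 := by
  ext v
  simp only [LinearEquiv.mul_apply, s_apply, map_sub, map_smul, co_self,
    LinearEquiv.coe_one, id]
  module

theorem s_mul_s_mul (i : Fin m) (w : V ≃ₗ[ℝ] V) : S.s i * (S.s i * w) = w := by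
  rw [← mul_assoc, s_mul_self, one_mul]

theorem mul_s_mul_s (i : Fin m) (w : V ≃ₗ[ℝ] V) : w * S.s i * S.s i = w := by
  rw [mul_assoc, s_mul_self, mul_one]

theorem s_inv (i : Fin m) : (S.s i)⁻¹ = S.s i := inv_eq_of_mul_eq_one_left (S.s_mul_self i)

theorem s_mem {I : Set (Fin m)} {i : Fin m} (hi : i ∈ I) : S.s i ∈ S.WI I :=
  Subgroup.subset_closure ⟨i, hi, rfl⟩

theorem co_offdiag {i j : Fin m} (h : i ≠ j) : S.coroot i (S.root j) ≤ 0 := by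
  rw [S.pairing]; exact_mod_cast S.A_offdiag i j h

/-- Words in `I`. -/
def IsWord (I : Set (Fin m)) (w : V ≃ₗ[ℝ] V) (l : List (Fin m)) : Prop :=
  (∀ i ∈ l, i ∈ I) ∧ w = (l.map S.s).prod

theorem exists_word {I : Set (Fin m)} {w : V ≃ₗ[ℝ] V} (hw : w ∈ S.WI I) :
    ∃ l, S.IsWord I w l := by
  induction hw using Subgroup.closure_induction with
  | mem x hx =>
    obtain ⟨i, hi, rfl⟩ := hx
    exact ⟨[i], by simpa using hi, by simp⟩
  | one => exact ⟨[], by simp, by simp⟩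
  | mul x y _ _ hx hy =>
    obtain ⟨l, hl, rfl⟩ := hx
    obtain ⟨k, hk, rfl⟩ := hy
    exact ⟨l ++ k, by simp only [List.mem_append]; rintro i (h | h); exacts [hl i h, hk i h], by simp⟩
  | inv x _ hx =>
    obtain ⟨l, hl, rfl⟩ := hx
    refine ⟨l.reverse, by simpa using hl, ?_⟩
    rw [List.prod_inv_reverse, List.map_map, List.map_reverse]
    congr 2

/-- Induction principle: right multiplication by simple reflections. -/
theorem word_mem {I : Set (Fin m)} {w : V ≃ₗ[ℝ] V} {l} (h : S.IsWord I w l) : w ∈ S.WI I := by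
  obtain ⟨hl, rfl⟩ := h
  apply Subgroup.list_prod_mem
  intro x hx
  obtain ⟨i, hi, rfl⟩ := List.mem_map.1 hx
  exact S.s_mem (hl i hi)

theorem WI_left_induction {I : Set (Fin m)} {P : (V ≃ₗ[ℝ] V) → Prop} (h1 : P 1)
    (hs : ∀ i ∈ I, ∀ w ∈ S.WI I, P w → P (S.s i * w)) : ∀ w ∈ S.WI I, P w := by
  intro w hw
  obtain ⟨l, hl⟩ := S.exists_word hw
  clear hw
  induction l generalizing w with
  | nil => obtain ⟨_, rfl⟩ := hl; simpa using h1
  | cons a l ih =>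
    obtain ⟨h, rfl⟩ := hl
    have hl' : S.IsWord I ((l.map S.s).prod) l := ⟨fun i hi => h i (by simp [hi]), rfl⟩
    simpa using hs a (h a (by simp)) _ (S.word_mem hl') (ih _ hl')

/-- length in `W_I`. -/
noncomputable def lenI (I : Set (Fin m)) (w : V ≃ₗ[ℝ] V) : ℕ :=
  sInf {n | ∃ l, S.IsWord I w l ∧ l.length = n}

theorem lenI_le {I : Set (Fin m)} {w : V ≃ₗ[ℝ] V} {l} (h : S.IsWord I w l) :
    S.lenI I w ≤ l.length := Nat.sInf_le ⟨l, h, rfl⟩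

theorem lenI_spec {I : Set (Fin m)} {w : V ≃ₗ[ℝ] V} (hw : w ∈ S.WI I) :
    ∃ l, S.IsWord I w l ∧ l.length = S.lenI I w := by
  obtain ⟨l, hl⟩ := S.exists_word hw
  exact Nat.sInf_mem (s := {n | ∃ l, S.IsWord I w l ∧ l.length = n}) ⟨_, l, hl, rfl⟩

theorem lenI_mul_s_le {I : Set (Fin m)} {w : V ≃ₗ[ℝ] V} (hw : w ∈ S.WI I) {i} (hi : i ∈ I) :
    S.lenI I (w * S.s i) ≤ S.lenI I w + 1 := by
  obtain ⟨l, hl, h⟩ := S.lenI_spec hw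
  have : S.IsWord I (w * S.s i) (l ++ [i]) := by
    refine ⟨?_, ?_⟩
    · simp only [List.mem_append, List.mem_singleton]
      rintro j (hj | rfl)
      exacts [hl.1 j hj, hi]
    · rw [hl.2]; simp
  have := S.lenI_le this
  simp at this
  omega

theorem exists_descent {I : Set (Fin m)} {w : V ≃ₗ[ℝ] V} (hw : w ∈ S.WI I) (h1 : w ≠ 1) :
    ∃ i ∈ I, S.lenI I (w * S.s i) < S.lenI I w := by
  obtain ⟨l, hl, h⟩ := S.lenI_spec hw
  rcases List.eq_nil_or_concat l with rfl | ⟨k, a, rfl⟩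
  · exact absurd hl.2 (by simpa using h1)
  · obtain ⟨h2, h3⟩ := hl
    refine ⟨a, h2 a (by simp), ?_⟩
    have : S.IsWord I (w * S.s a) k := by
      refine ⟨fun i hi => h2 i (by simp [hi]), ?_⟩
      rw [h3]
      simp [mul_assoc, s_mul_self]
    have := S.lenI_le this
    simp at h
    omega

/-- alternating word `… s t` of length `k` (last letter `t`). -/
def alt (a b : Fin m) : ℕ → (V ≃ₗ[ℝ] V)
  | 0 => 1
  | k + 1 => S.s (if Even k then b else a) * alt a b k

theorem lenI_mul_alt {I : Set (Fin m)} {a b : Fin m} (ha : a ∈ I) (hb : b ∈ I) (k : ℕ) :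
    ∀ v ∈ S.WI I, S.lenI I (v * S.alt a b k) ≤ S.lenI I v + k := by
  induction k with
  | zero => intro v hv; simp [alt]
  | succ k ih =>
    intro v hv
    have hx : (if Even k then b else a) ∈ I := by split_ifs <;> assumption
    have := ih (v * S.s (if Even k then b else a)) (mul_mem hv (S.s_mem hx))
    have h2 := S.lenI_mul_s_le hv hx
    rw [alt, ← mul_assoc]
    omega

theorem coneNonneg_zero (I : Set (Fin m)) : (0 : V) ∈ S.coneNonneg I := ⟨0, by simp⟩

theorem coneNonneg_add {I : Set (Fin m)} {x y : V} (hx : x ∈ S.coneNonneg I)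
    (hy : y ∈ S.coneNonneg I) : x + y ∈ S.coneNonneg I := by
  obtain ⟨c, h1, h2, rfl⟩ := hx
  obtain ⟨d, h3, h4, rfl⟩ := hy
  refine ⟨c + d, fun i => add_nonneg (h1 i) (h3 i), fun i hi => by simp [h2 i hi, h4 i hi], ?_⟩
  simp [add_smul, Finset.sum_add_distrib]

theorem coneNonneg_smul {I : Set (Fin m)} {x : V} (hx : x ∈ S.coneNonneg I) {r : ℝ} (hr : 0 ≤ r) :
    r • x ∈ S.coneNonneg I := by
  obtain ⟨c, h1, h2, rfl⟩ := hx
  refine ⟨r • c, fun i => mul_nonneg hr (h1 i), fun i hi => by simp [h2 i hi], ?_⟩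
  simp [mul_smul, Finset.smul_sum]

theorem root_mem_cone {I : Set (Fin m)} {i : Fin m} (hi : i ∈ I) : S.root i ∈ S.coneNonneg I := by
  classical
  refine ⟨Pi.single i 1, fun j => ?_, fun j hj => ?_, ?_⟩
  · by_cases h : j = i
    · subst h; simp
    · simp [h]
  · have : j ≠ i := by rintro rfl; exact hj hi
    simp [this]
  · simp [Pi.single_apply]

end Aux

end GCMRealization

namespace GCMRealization

section Tits

variable {m : ℕ} {V : Type*} [NormedAddCommGroup V] [NormedSpace ℝ V]
variable (S : GCMRealization m V)

/-- coefficients of the image of a simple root under alternating words -/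
noncomputable def pq (x y : ℝ) : ℕ → ℝ × ℝ
  | 0 => (1, 0)
  | k + 1 => if Even k then ((pq x y k).1, y * (pq x y k).1 - (pq x y k).2)
      else (x * (pq x y k).2 - (pq x y k).1, (pq x y k).2)

theorem alt_root {a b : Fin m} {x y : ℝ} (hx : S.coroot a (S.root b) = -x)
    (hy : S.coroot b (S.root a) = -y) (k : ℕ) :
    S.alt a b k (S.root a) = (pq x y k).1 • S.root a + (pq x y k).2 • S.root b := by
  induction k with
  | zero => simp [alt, pq]
  | succ k ih =>
    rw [alt, LinearEquiv.mul_apply, ih, pq]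
    split_ifs
    · simp only [s_apply, map_add, map_smul, co_self, hy, smul_eq_mul]
      module
    · simp only [s_apply, map_add, map_smul, co_self, hx, smul_eq_mul]
      module

theorem pq_nonneg {x y : ℝ} (hx : 0 ≤ x) (hy : 0 ≤ y) (hxy : 4 ≤ x * y) (k : ℕ) :
    0 ≤ (pq x y k).1 ∧ 0 ≤ (pq x y k).2 ∧
      (if Even k then 2 * (pq x y k).2 ≤ y * (pq x y k).1
        else 2 * (pq x y k).1 ≤ x * (pq x y k).2) := by
  induction k with
  | zero => simp [pq, hy]
  | succ k ih =>
    obtain ⟨h1, h2, h3⟩ := ih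
    rw [pq]
    by_cases h : Even k
    · have h' : ¬ Even (k + 1) := by simpa [Nat.even_add_one] using h
      rw [if_pos h] at h3
      rw [if_pos h, if_neg h']
      refine ⟨h1, by simp only []; linarith, ?_⟩
      simp only []
      nlinarith [mul_le_mul_of_nonneg_left h3 hx, mul_le_mul_of_nonneg_right hxy h1]
    · have h' : Even (k + 1) := by simpa [Nat.even_add_one] using h
      rw [if_neg h] at h3
      rw [if_neg h, if_pos h']
      refine ⟨by simp only []; linarith, h2, ?_⟩
      simp only []
      nlinarith [mul_le_mul_of_nonneg_left h3 hy, mul_le_mul_of_nonneg_right hxy h2]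

theorem ev2 : Even 2 := by decide
theorem ev4 : Even 4 := by decide
theorem ev1 : ¬ Even 1 := by decide
theorem ev3 : ¬ Even 3 := by decide
theorem ev5 : ¬ Even 5 := by decide

theorem rank_two {a b : Fin m} (hab : a ≠ b) :
    ∃ x y : ℝ, S.coroot a (S.root b) = -x ∧ S.coroot b (S.root a) = -y ∧
    ((∀ k, 0 ≤ (pq x y k).1 ∧ 0 ≤ (pq x y k).2) ∨
      ∃ M, 1 ≤ M ∧ (∀ k < M, 0 ≤ (pq x y k).1 ∧ 0 ≤ (pq x y k).2) ∧
        S.alt a b M = S.alt b a M) := by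
  have e1 := S.A_offdiag a b hab
  have e2 := S.A_offdiag b a hab.symm
  have e3 := S.A_zero_iff a b
  have p1 := S.pairing a b
  have p2 := S.pairing b a
  obtain ⟨x, hx⟩ : ∃ x : ℤ, S.A a b = -x := ⟨-S.A a b, by simp⟩
  obtain ⟨y, hy⟩ : ∃ y : ℤ, S.A b a = -y := ⟨-S.A b a, by simp⟩
  rw [hx] at p1 e1 e3
  rw [hy] at p2 e2 e3
  have hx0 : 0 ≤ x := by linarith
  have hy0 : 0 ≤ y := by linarith
  refine ⟨x, y, by rw [p1]; simp, by rw [p2]; simp, ?_⟩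
  by_cases h4 : 4 ≤ x * y
  · left
    intro k
    have := pq_nonneg (x := (x : ℝ)) (y := (y : ℝ)) (by exact_mod_cast hx0) (by exact_mod_cast hy0)
      (by exact_mod_cast h4) k
    exact ⟨this.1, this.2.1⟩
  · right
    have h4' : x * y < 4 := not_le.1 h4
    have hcases : (x = 0 ∧ y = 0) ∨ (x = 1 ∧ y = 1) ∨ (x = 1 ∧ y = 2) ∨ (x = 2 ∧ y = 1) ∨
        (x = 1 ∧ y = 3) ∨ (x = 3 ∧ y = 1) := by
      rcases hx0.eq_or_lt with h | h
      · left
        refine ⟨h.symm, ?_⟩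
        have := e3.1 (by simp [← h])
        linarith
      · have hy1 : 0 < y := by
          rcases hy0.eq_or_lt with h' | h'
          · have := e3.2 (by simp [← h'])
            omega
          · exact h'
        have hx4 : x < 4 := by nlinarith
        have hy4 : y < 4 := by nlinarith
        interval_cases x <;> interval_cases y <;> simp_all
    clear h4 h4' e1 e2 e3 hx hy hx0 hy0
    rcases hcases with ⟨rfl, rfl⟩ | ⟨rfl, rfl⟩ | ⟨rfl, rfl⟩ | ⟨rfl, rfl⟩ | ⟨rfl, rfl⟩ | ⟨rfl, rfl⟩
    · refine ⟨2, by norm_num, ?_, ?_⟩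
      · intro k hk
        interval_cases k <;> norm_num [pq, ev1, ev2, ev3, ev4]
      · ext v
        simp only [alt, ev1, ev2, ev3, ev4, ev5, Even.zero, if_true, if_false, LinearEquiv.mul_apply,
          s_apply, map_sub, map_smul, co_self, p1, p2, LinearEquiv.coe_one, id]
        push_cast
        module
    · refine ⟨3, by norm_num, ?_, ?_⟩
      · intro k hk
        interval_cases k <;> norm_num [pq, ev1, ev2, ev3, ev4]
      · ext v
        simp only [alt, ev1, ev2, ev3, ev4, ev5, Even.zero, if_true, if_false, LinearEquiv.mul_apply,
          s_apply, map_sub, map_smul, co_self, p1, p2, LinearEquiv.coe_one, id]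
        push_cast
        module
    · refine ⟨4, by norm_num, ?_, ?_⟩
      · intro k hk
        interval_cases k <;> norm_num [pq, ev1, ev2, ev3, ev4]
      · ext v
        simp only [alt, ev1, ev2, ev3, ev4, ev5, Even.zero, if_true, if_false, LinearEquiv.mul_apply,
          s_apply, map_sub, map_smul, co_self, p1, p2, LinearEquiv.coe_one, id]
        push_cast
        module
    · refine ⟨4, by norm_num, ?_, ?_⟩
      · intro k hk
        interval_cases k <;> norm_num [pq, ev1, ev2, ev3, ev4]
      · ext v
        simp only [alt, ev1, ev2, ev3, ev4, ev5, Even.zero, if_true, if_false, LinearEquiv.mul_apply,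
          s_apply, map_sub, map_smul, co_self, p1, p2, LinearEquiv.coe_one, id]
        push_cast
        module
    · refine ⟨6, by norm_num, ?_, ?_⟩
      · intro k hk
        interval_cases k <;> norm_num [pq, ev1, ev2, ev3, ev4]
      · ext v
        simp only [alt, ev1, ev2, ev3, ev4, ev5, Even.zero, if_true, if_false, LinearEquiv.mul_apply,
          s_apply, map_sub, map_smul, co_self, p1, p2, LinearEquiv.coe_one, id]
        push_cast
        module
    · refine ⟨6, by norm_num, ?_, ?_⟩
      · intro k hk
        interval_cases k <;> norm_num [pq, ev1, ev2, ev3, ev4]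
      · ext v
        simp only [alt, ev1, ev2, ev3, ev4, ev5, Even.zero, if_true, if_false, LinearEquiv.mul_apply,
          s_apply, map_sub, map_smul, co_self, p1, p2, LinearEquiv.coe_one, id]
        push_cast
        module

theorem alt_mul_s (a b : Fin m) (k : ℕ) : S.alt a b k * S.s a = S.alt b a (k + 1) := by
  induction k with
  | zero => simp [alt]
  | succ k ih =>
    rw [alt, mul_assoc, ih, alt.eq_def S b a (k + 1 + 1)]
    simp only [Nat.even_add_one]
    by_cases h : Even k <;> simp [h]

/-- If `k ≥ M` and the braid relation of length `M` holds, the word can be shortened. -/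
theorem alt_split (a b : Fin m) (j : ℕ) : ∀ M, ∃ g : V ≃ₗ[ℝ] V,
    S.alt a b (M + j) = g * S.alt a b M ∧
    ∀ I : Set (Fin m), a ∈ I → b ∈ I → ∀ v ∈ S.WI I, v * g ∈ S.WI I ∧
      S.lenI I (v * g) ≤ S.lenI I v + j := by
  induction j with
  | zero => exact fun M => ⟨1, by simp, fun I _ _ v hv => by simpa using hv⟩
  | succ j ih =>
    intro M
    obtain ⟨g, h1, h2⟩ := ih M
    refine ⟨S.s (if Even (M + j) then b else a) * g, ?_, ?_⟩
    · rw [← add_assoc, alt, h1, mul_assoc]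
    · intro I ha hb v hv
      have hx : (if Even (M + j) then b else a) ∈ I := by split_ifs <;> assumption
      have := h2 I ha hb _ (mul_mem hv (S.s_mem hx))
      have h3 := S.lenI_mul_s_le hv hx
      rw [← mul_assoc]
      exact ⟨this.1, by omega⟩

theorem alt_mem {I : Set (Fin m)} {a b : Fin m} (ha : a ∈ I) (hb : b ∈ I) (k : ℕ) :
    S.alt a b k ∈ S.WI I := by
  induction k with
  | zero => exact one_mem _
  | succ k ih =>
    exact mul_mem (S.s_mem (by split_ifs <;> assumption)) ih

/-- The Tits lemma. -/
theorem tits {I : Set (Fin m)} : ∀ n : ℕ, ∀ w ∈ S.WI I, S.lenI I w = n → ∀ a ∈ I,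
    S.lenI I w ≤ S.lenI I (w * S.s a) → w (S.root a) ∈ S.coneNonneg I := by
  intro n
  induction n using Nat.strong_induction_on with
  | _ n ih =>
  intro w hw hn a ha hle
  by_cases h1 : w = 1
  · subst h1
    simpa using S.root_mem_cone ha
  obtain ⟨b, hb, hlt⟩ := S.exists_descent hw h1
  have hab : a ≠ b := by rintro rfl; omega
  -- the decompositions
  let P : ℕ → Prop := fun k => S.lenI I (w * (S.alt a b k)⁻¹) + k = S.lenI I w
  have hmem : ∀ k, w * (S.alt a b k)⁻¹ ∈ S.WI I := fun k =>
    mul_mem hw (inv_mem (S.alt_mem ha hb k))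
  have hub : ∀ k, S.lenI I w ≤ S.lenI I (w * (S.alt a b k)⁻¹) + k := by
    intro k
    have := S.lenI_mul_alt ha hb k _ (hmem k)
    simpa using this
  have hP1 : P 1 := by
    have := S.lenI_mul_s_le (mul_mem hw (S.s_mem hb)) hb
    rw [mul_s_mul_s] at this
    simp only [P, alt, Even.zero, if_true, mul_one, s_inv]
    omega
  obtain ⟨k, hk, hPk, hmax⟩ : ∃ k, 1 ≤ k ∧ P k ∧ ∀ j, P j → j ≤ k := by
    classical
    have hb' : ∀ j, P j → j ≤ S.lenI I w := fun j hj => by simp only [P] at hj; omega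
    refine ⟨Nat.findGreatest P (S.lenI I w), ?_, ?_, ?_⟩
    · exact Nat.le_findGreatest (hb' 1 hP1) hP1
    · exact Nat.findGreatest_spec (hb' 1 hP1) hP1
    · exact fun j hj => Nat.le_findGreatest (hb' j hj) hj
  set v := w * (S.alt a b k)⁻¹ with hv
  have hwv : w = v * S.alt a b k := by simp [hv]
  have hvm : v ∈ S.WI I := hmem k
  have hPk' : S.lenI I v + k = S.lenI I w := hPk
  -- next letter
  have hnext : S.lenI I v ≤ S.lenI I (v * S.s (if Even k then b else a)) := by
    by_contra hcon
    have h2 : w * (S.alt a b (k + 1))⁻¹ = v * S.s (if Even k then b else a) := by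
      rw [alt, mul_inv_rev, ← mul_assoc, s_inv]
    have : P (k + 1) := by
      have := hub (k + 1)
      simp only [P]
      rw [h2] at this ⊢
      omega
    have := hmax _ this
    omega
  have hprev : S.lenI I v ≤ S.lenI I (v * S.s (if Even k then a else b)) := by
    obtain ⟨j, rfl⟩ : ∃ j, k = j + 1 := ⟨k - 1, by omega⟩
    have h2 : w * (S.alt a b j)⁻¹ = v * S.s (if Even (j + 1) then a else b) := by
      rw [hv, alt, mul_inv_rev, s_inv, mul_assoc, mul_assoc]
      simp only [Nat.even_add_one]
      by_cases h : Even j <;> simp [h, s_mul_self]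
    have := hub j
    rw [h2] at this
    omega
  have hva : S.lenI I v ≤ S.lenI I (v * S.s a) := by
    by_cases h : Even k <;> simp only [h, if_true, if_false] at hnext hprev <;> assumption
  have hvb : S.lenI I v ≤ S.lenI I (v * S.s b) := by
    by_cases h : Even k <;> simp only [h, if_true, if_false] at hnext hprev <;> assumption
  have hra := ih (S.lenI I v) (by omega) v hvm rfl a ha hva
  have hrb := ih (S.lenI I v) (by omega) v hvm rfl b hb hvb
  obtain ⟨x, y, hx, hy, hor⟩ := S.rank_two hab
  have key : 0 ≤ (pq x y k).1 ∧ 0 ≤ (pq x y k).2 := by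
    rcases hor with h | ⟨M, hM, h, hbr⟩
    · exact h k
    · by_cases hkM : k < M
      · exact h k hkM
      · exfalso
        obtain ⟨g, hg, hg2⟩ := S.alt_split a b (k - M) M
        rw [show M + (k - M) = k by omega, hbr] at hg
        obtain ⟨hg3, hg4⟩ := hg2 I ha hb v hvm
        obtain ⟨N, rfl⟩ : ∃ N, M = N + 1 := ⟨M - 1, by omega⟩
        have h5 : w * S.s a = (v * g) * S.alt a b N := by
          rw [hwv, hg, ← alt_mul_s]
          simp only [mul_assoc, s_mul_self, mul_one]
        have h6 := S.lenI_mul_alt ha hb N _ hg3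
        rw [← h5] at h6
        omega
  rw [hwv, LinearEquiv.mul_apply, S.alt_root hx hy, map_add, map_smul, map_smul]
  exact S.coneNonneg_add (S.coneNonneg_smul hra key.1) (S.coneNonneg_smul hrb key.2)

/-- Dominance: `v - w v ∈ ℝ₊I`. -/
theorem dominance {I : Set (Fin m)} {v : V} (hv : ∀ i ∈ I, 0 ≤ S.coroot i v) :
    ∀ w ∈ S.WI I, v - w v ∈ S.coneNonneg I := by
  suffices h : ∀ n : ℕ, ∀ w ∈ S.WI I, S.lenI I w = n → v - w v ∈ S.coneNonneg I from
    fun w hw => h _ w hw rfl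
  intro n
  induction n using Nat.strong_induction_on with
  | _ n ih =>
  intro w hw hn
  by_cases h1 : w = 1
  · subst h1
    simpa using S.coneNonneg_zero I
  obtain ⟨b, hb, hlt⟩ := S.exists_descent hw h1
  have hm := mul_mem hw (S.s_mem hb)
  have h2 := ih _ (by omega) _ hm rfl
  have h3 := S.tits _ _ hm rfl b hb (by rw [mul_s_mul_s]; omega)
  have h4 : v - w v = (v - (w * S.s b) v) + S.coroot b v • (w * S.s b) (S.root b) := by
    simp only [LinearEquiv.mul_apply, s_apply, map_sub, map_smul, co_self]
    module
  rw [h4]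
  exact S.coneNonneg_add h2 (S.coneNonneg_smul h3 (hv b hb))

end Tits

end GCMRealization

namespace GCMRealization

section Fin

variable {m : ℕ} {V : Type*} [NormedAddCommGroup V] [NormedSpace ℝ V]
variable (S : GCMRealization m V)

theorem co_le_neg_one {i j : Fin m} (h : i ≠ j) (h0 : S.coroot i (S.root j) ≠ 0) :
    S.coroot i (S.root j) ≤ -1 := by
  rw [S.pairing] at h0 ⊢
  have h1 := S.A_offdiag i j h
  have h2 : S.A i j ≠ 0 := by exact_mod_cast h0
  have : S.A i j ≤ -1 := by omega
  exact_mod_cast this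

theorem co_zero_symm {i j : Fin m} (h0 : S.coroot i (S.root j) = 0) :
    S.coroot j (S.root i) = 0 := by
  rw [S.pairing] at h0 ⊢
  have h2 : S.A i j = 0 := by exact_mod_cast h0
  exact_mod_cast (S.A_zero_iff i j).1 h2

theorem symmetrizer (u : Fin m → ℝ) (L : Finset (Fin m)) : (∀ i ∈ L, 0 < u i) →
    (∀ i ∈ L, 0 < ∑ j ∈ L, S.coroot i (S.root j) * u j) →
    ∃ d : Fin m → ℝ, (∀ i, 0 < d i) ∧ ∀ i ∈ L, ∀ j ∈ L,
      d i * S.coroot i (S.root j) = d j * S.coroot j (S.root i) := by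
  classical
  induction L using Finset.strongInduction with
  | _ L ih =>
  intro hu hA
  rcases L.eq_empty_or_nonempty with rfl | hne
  · exact ⟨1, by simp, by simp⟩
  obtain ⟨k, hk, hmin⟩ := Finset.exists_min_image L u hne
  have claim : ∀ p ∈ L.erase k, ∀ q ∈ L.erase k, p ≠ q → S.coroot k (S.root p) ≠ 0 →
      S.coroot k (S.root q) = 0 := by
    intro p hp q hq hpq h1
    by_contra h2
    rw [Finset.mem_erase] at hp hq
    have h3 := hA k hk
    have hpu := hmin p hp.2
    have hqu := hmin q hq.2
    have e1 := S.co_le_neg_one hp.1.symm h1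
    have e2 := S.co_le_neg_one hq.1.symm h2
    have hsub : ({k, p, q} : Finset (Fin m)) ⊆ L := by
      intro x hx
      simp only [Finset.mem_insert, Finset.mem_singleton] at hx
      rcases hx with rfl | rfl | rfl
      exacts [hk, hp.2, hq.2]
    have h4 : ∑ j ∈ L, S.coroot k (S.root j) * u j ≤
        ∑ j ∈ ({k, p, q} : Finset (Fin m)), S.coroot k (S.root j) * u j := by
      rw [← Finset.sum_sdiff hsub]
      have : ∑ j ∈ L \ {k, p, q}, S.coroot k (S.root j) * u j ≤ 0 := by
        apply Finset.sum_nonpos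
        intro j hj
        simp only [Finset.mem_sdiff, Finset.mem_insert, not_or] at hj
        exact mul_nonpos_of_nonpos_of_nonneg (S.co_offdiag (Ne.symm hj.2.1)) (hu j hj.1).le
      linarith
    rw [Finset.sum_insert (by simp [hp.1.symm, hq.1.symm]), Finset.sum_pair hpq, co_self] at h4
    have := hu k hk
    nlinarith
  have hlt : L.erase k ⊂ L := Finset.erase_ssubset hk
  obtain ⟨d, hd, hsym⟩ := ih _ hlt (fun i hi => hu i (Finset.mem_of_mem_erase hi)) (by
    intro i hi
    have h1 := hA i (Finset.mem_of_mem_erase hi)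
    rw [← Finset.add_sum_erase _ _ hk] at h1
    have h2 := S.co_offdiag (Finset.ne_of_mem_erase hi)
    have := mul_nonpos_of_nonpos_of_nonneg h2 (hu k hk).le
    linarith)
  by_cases hp : ∃ p ∈ L.erase k, S.coroot k (S.root p) ≠ 0
  · obtain ⟨p, hp, hne0⟩ := hp
    have hpk : p ≠ k := Finset.ne_of_mem_erase hp
    have hne1 : S.coroot p (S.root k) ≠ 0 := fun h => hne0 (S.co_zero_symm h)
    have g1 := S.co_le_neg_one hpk.symm hne0
    have g2 := S.co_le_neg_one hpk hne1
    have main : ∀ j ∈ L.erase k, d p * S.coroot p (S.root k) / S.coroot k (S.root p) *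
        S.coroot k (S.root j) = d j * S.coroot j (S.root k) := by
      intro j hj
      by_cases hjp : j = p
      · subst hjp; field_simp
      · have := claim p hp j hj (Ne.symm hjp) hne0
        rw [this, S.co_zero_symm this]; simp
    refine ⟨Function.update d k (d p * S.coroot p (S.root k) / S.coroot k (S.root p)), ?_, ?_⟩
    · intro i
      by_cases h : i = k
      · subst h
        simp only [Function.update_self]
        exact div_pos_of_neg_of_neg (mul_neg_of_pos_of_neg (hd p) (by linarith)) (by linarith)
      · simp [h, hd i]
    · intro i hi j hj
      by_cases h : i = k
      · by_cases h' : j = k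
        · subst h; subst h'; rfl
        · subst h
          simp only [Function.update_self, Function.update_of_ne h']
          exact main j (Finset.mem_erase.2 ⟨h', hj⟩)
      · by_cases h' : j = k
        · subst h'
          simp only [Function.update_self, Function.update_of_ne h]
          exact (main i (Finset.mem_erase.2 ⟨h, hi⟩)).symm
        · simp only [Function.update_of_ne h, Function.update_of_ne h']
          exact hsym i (Finset.mem_erase.2 ⟨h, hi⟩) j (Finset.mem_erase.2 ⟨h', hj⟩)
  · push Not at hp
    refine ⟨d, hd, ?_⟩
    intro i hi j hj
    by_cases h : i = k
    · by_cases h' : j = k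
      · subst h; subst h'; rfl
      · subst h
        have := hp j (Finset.mem_erase.2 ⟨h', hj⟩)
        rw [this, S.co_zero_symm this]; simp
    · by_cases h' : j = k
      · subst h'
        have := hp i (Finset.mem_erase.2 ⟨h, hi⟩)
        rw [this, S.co_zero_symm this]; simp
      · exact hsym i (Finset.mem_erase.2 ⟨h, hi⟩) j (Finset.mem_erase.2 ⟨h', hj⟩)

/-- the quadratic form -/
def qf (d : Fin m → ℝ) (L : Finset (Fin m)) (c : Fin m → ℝ) : ℝ :=
  ∑ i ∈ L, ∑ j ∈ L, d i * S.coroot i (S.root j) * (c i * c j)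

theorem qf_lower {d u : Fin m → ℝ} {L : Finset (Fin m)} (hu : ∀ i ∈ L, 0 < u i)
    (hd : ∀ i, 0 < d i) (hsym : ∀ i ∈ L, ∀ j ∈ L,
      d i * S.coroot i (S.root j) = d j * S.coroot j (S.root i)) (c : Fin m → ℝ) :
    ∑ i ∈ L, d i * (∑ j ∈ L, S.coroot i (S.root j) * u j) / u i * (c i) ^ 2 ≤ S.qf d L c := by
  have h1 : ∑ i ∈ L, d i * (∑ j ∈ L, S.coroot i (S.root j) * u j) / u i * (c i) ^ 2 =
      ∑ i ∈ L, ∑ j ∈ L, d i * S.coroot i (S.root j) * (u j / u i * c i ^ 2) := by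
    apply Finset.sum_congr rfl
    intro i hi
    rw [Finset.mul_sum, Finset.sum_div, Finset.sum_mul]
    apply Finset.sum_congr rfl
    intro j hj
    ring
  have h2 : ∑ i ∈ L, ∑ j ∈ L, d i * S.coroot i (S.root j) * (u j / u i * c i ^ 2) =
      ∑ i ∈ L, ∑ j ∈ L, d i * S.coroot i (S.root j) * (u i / u j * c j ^ 2) := by
    rw [Finset.sum_comm]
    apply Finset.sum_congr rfl
    intro i hi
    apply Finset.sum_congr rfl
    intro j hj
    rw [hsym j hj i hi]
  have h3 : ∑ i ∈ L, ∑ j ∈ L, d i * S.coroot i (S.root j) * (u j / u i * c i ^ 2) +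
      ∑ i ∈ L, ∑ j ∈ L, d i * S.coroot i (S.root j) * (u i / u j * c j ^ 2) ≤
      2 * S.qf d L c := by
    rw [qf, Finset.mul_sum, ← Finset.sum_add_distrib]
    apply Finset.sum_le_sum
    intro i hi
    rw [Finset.mul_sum, ← Finset.sum_add_distrib]
    apply Finset.sum_le_sum
    intro j hj
    have hui := hu i hi
    have huj := hu j hj
    by_cases h : i = j
    · subst h
      have : u i / u i = 1 := div_self hui.ne'
      rw [this]
      apply le_of_eq
      ring
    · have e1 : d i * S.coroot i (S.root j) ≤ 0 :=
        mul_nonpos_of_nonneg_of_nonpos (hd i).le (S.co_offdiag h)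
      have e2 : 2 * (c i * c j) ≤ u j / u i * c i ^ 2 + u i / u j * c j ^ 2 := by
        have : u j / u i * c i ^ 2 + u i / u j * c j ^ 2 - 2 * (c i * c j) =
          (u j * c i - u i * c j) ^ 2 / (u i * u j) := by field_simp; ring
        have h0 : 0 ≤ (u j * c i - u i * c j) ^ 2 / (u i * u j) := by positivity
        linarith
      nlinarith
  linarith

theorem qf_refl {d : Fin m → ℝ} {L : Finset (Fin m)} (hsym : ∀ i ∈ L, ∀ j ∈ L,
      d i * S.coroot i (S.root j) = d j * S.coroot j (S.root i)) (c : Fin m → ℝ) {k : Fin m}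
    (hk : k ∈ L) (t : ℝ) (ht : t = ∑ j ∈ L, S.coroot k (S.root j) * c j) :
    S.qf d L (fun i => c i - if i = k then t else 0) = S.qf d L c := by
  classical
  have h1 : S.qf d L (fun i => c i - if i = k then t else 0) = S.qf d L c
      - t * (∑ i ∈ L, d i * S.coroot i (S.root k) * c i)
      - t * (∑ j ∈ L, d k * S.coroot k (S.root j) * c j)
      + t * t * (d k * S.coroot k (S.root k)) := by
    have e : ∀ i j : Fin m, d i * S.coroot i (S.root j) *
        ((c i - if i = k then t else 0) * (c j - if j = k then t else 0)) =
        d i * S.coroot i (S.root j) * (c i * c j)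
        - (if j = k then t * (d i * S.coroot i (S.root j) * c i) else 0)
        - (if i = k then t * (d i * S.coroot i (S.root j) * c j) else 0)
        + (if i = k then (if j = k then t * t * (d i * S.coroot i (S.root j)) else 0) else 0) := by
      intro i j
      split_ifs <;> ring
    simp only [qf, e, Finset.sum_add_distrib, Finset.sum_sub_distrib, Finset.mul_sum]
    have f1 : ∑ i ∈ L, ∑ j ∈ L, (if i = k then t * (d i * S.coroot i (S.root j) * c j) else 0) =
        ∑ j ∈ L, t * (d k * S.coroot k (S.root j) * c j) := by
      rw [Finset.sum_comm]; simp [hk]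
    have f2 : ∑ i ∈ L, ∑ j ∈ L, (if i = k then
        (if j = k then t * t * (d i * S.coroot i (S.root j)) else 0) else 0) =
        t * t * (d k * S.coroot k (S.root k)) := by
      rw [Finset.sum_comm]; simp [hk]
    rw [f1, f2]
    simp [hk]
  have h2 : ∑ i ∈ L, d i * S.coroot i (S.root k) * c i =
      ∑ j ∈ L, d k * S.coroot k (S.root j) * c j :=
    Finset.sum_congr rfl (fun i hi => by rw [hsym i hi k hk])
  have h3 : ∑ j ∈ L, d k * S.coroot k (S.root j) * c j = d k * t := by
    rw [ht, Finset.mul_sum]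
    exact Finset.sum_congr rfl (fun i hi => by ring)
  rw [h1, h2, h3, co_self]
  ring

theorem finite_roots {u : Fin m → ℝ} {L : Finset (Fin m)} (hu : ∀ i ∈ L, 0 < u i)
    (hA : ∀ i ∈ L, 0 < ∑ j ∈ L, S.coroot i (S.root j) * u j) :
    ∃ T : Set V, T.Finite ∧ ∀ w ∈ S.WI (L : Set (Fin m)), ∀ i ∈ L, w (S.root i) ∈ T := by
  classical
  obtain ⟨d, hd, hsym⟩ := S.symmetrizer u L hu hA
  have key : ∀ i ∈ L, ∀ w ∈ S.WI (L : Set (Fin m)), ∃ n : Fin m → ℤ, (∀ j, j ∉ L → n j = 0) ∧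
      w (S.root i) = ∑ j, (n j : ℝ) • S.root j ∧
      S.qf d L (fun j => n j) = S.qf d L (Pi.single i 1) := by
    intro i hi
    refine S.WI_left_induction (P := fun w => ∃ n : Fin m → ℤ, (∀ j, j ∉ L → n j = 0) ∧
      w (S.root i) = ∑ j, (n j : ℝ) • S.root j ∧
      S.qf d L (fun j => n j) = S.qf d L (Pi.single i 1)) ?_ ?_
    · refine ⟨Pi.single i 1, ?_, ?_, ?_⟩
      · intro j hj
        have : j ≠ i := by rintro rfl; exact hj hi
        simp [this]
      · simp [Pi.single_apply]
      · congr 1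
        ext j
        by_cases h : j = i
        · subst h; simp
        · simp [h]
    · rintro k hk w hw ⟨n, h1, h2, h3⟩
      have hk' : k ∈ L := hk
      have hco : S.coroot k (w (S.root i)) = ((∑ j, S.A k j * n j : ℤ) : ℝ) := by
        rw [h2, map_sum]
        push_cast
        apply Finset.sum_congr rfl
        intro j _
        rw [map_smul, S.pairing, smul_eq_mul, mul_comm]
      refine ⟨fun j => n j - if j = k then (∑ j, S.A k j * n j) else 0, ?_, ?_, ?_⟩
      · intro j hj
        have : j ≠ k := by rintro rfl; exact hj hk'
        simp [h1 j hj, this]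
      · rw [LinearEquiv.mul_apply, s_apply, hco, h2]
        push_cast
        simp [sub_smul, Finset.sum_sub_distrib, ite_smul]
      · rw [← h3, ← S.qf_refl hsym (fun j => (n j : ℝ)) hk' _ rfl]
        congr 1
        ext j
        push_cast
        congr 2
        rw [← Finset.sum_subset (Finset.subset_univ L)]
        · exact Finset.sum_congr rfl fun j _ => by rw [S.pairing]
        · intro j _ hj
          simp [h1 j hj]
  -- bound
  let B : Fin m → ℝ := fun j => ∑ i ∈ L, |S.qf d L (Pi.single i 1)| /
    (d j * (∑ k ∈ L, S.coroot j (S.root k) * u k) / u j)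
  refine ⟨(fun n : Fin m → ℤ => ∑ j, (n j : ℝ) • S.root j) ''
    (Set.pi Set.univ fun j => {z : ℤ | |z| ≤ ⌈|B j|⌉}), ?_, ?_⟩
  · apply Set.Finite.image
    apply Set.Finite.pi
    intro j
    apply (Set.finite_Icc (-⌈|B j|⌉) (⌈|B j|⌉)).subset
    intro z hz
    exact abs_le.1 hz
  · intro w hw i hi
    obtain ⟨n, h1, h2, h3⟩ := key i hi w hw
    refine ⟨n, ?_, h2.symm⟩
    intro j _
    by_cases hj : j ∈ L
    · have h4 := S.qf_lower hu hd hsym (fun j => (n j : ℝ))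
      rw [h3] at h4
      set κ : Fin m → ℝ := fun j => d j * (∑ k ∈ L, S.coroot j (S.root k) * u k) / u j with hκ
      have hκpos : ∀ j ∈ L, 0 < κ j := fun j hj => div_pos (mul_pos (hd j) (hA j hj)) (hu j hj)
      have h5 : κ j * (n j : ℝ) ^ 2 ≤ ∑ i ∈ L, κ i * (n i : ℝ) ^ 2 :=
        Finset.single_le_sum (f := fun i => κ i * (n i : ℝ) ^ 2)
          (fun i hi => mul_nonneg (hκpos i hi).le (sq_nonneg _)) hj
      have h6 : (n j : ℝ) ^ 2 ≤ |S.qf d L (Pi.single i 1)| / κ j := by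
        rw [le_div_iff₀ (hκpos j hj)]
        have := le_abs_self (S.qf d L (Pi.single i 1))
        linarith
      have h7 : |S.qf d L (Pi.single i 1)| / κ j ≤ B j :=
        Finset.single_le_sum (f := fun i => |S.qf d L (Pi.single i 1)| / κ j)
          (fun i hi => div_nonneg (abs_nonneg _) (hκpos j hj).le) hi
      have h8 : (n j) ^ 2 ≤ ⌈|B j|⌉ := by
        have : ((n j : ℝ)) ^ 2 ≤ (⌈|B j|⌉ : ℝ) :=
          (h6.trans h7).trans ((le_abs_self _).trans (Int.le_ceil _))
        exact_mod_cast this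
      have h9 : |n j| ≤ (n j) ^ 2 := by
        rw [← sq_abs]
        exact Int.le_self_sq _
      exact h9.trans h8
    · simp [h1 j hj]
      exact Int.ceil_nonneg (abs_nonneg _)

/-- Every functional can be moved to be `L`-dominant. -/
theorem make_dominant {u : Fin m → ℝ} {L : Finset (Fin m)} (hu : ∀ i ∈ L, 0 < u i)
    (hA : ∀ i ∈ L, 0 < ∑ j ∈ L, S.coroot i (S.root j) * u j) (f : V →ₗ[ℝ] ℝ) :
    ∃ w ∈ S.WI (L : Set (Fin m)), ∀ i ∈ L, 0 ≤ f (w (S.root i)) := by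
  classical
  obtain ⟨T, hT, hwT⟩ := S.finite_roots hu hA
  let x : V := ∑ i ∈ L, u i • S.root i
  have hcx : ∀ i ∈ L, 0 < S.coroot i x := by
    intro i hi
    have := hA i hi
    simp only [x, map_sum, map_smul, smul_eq_mul]
    simpa [mul_comm] using this
  let O : Set ℝ := (fun w : V ≃ₗ[ℝ] V => f (w x)) '' (S.WI (L : Set (Fin m)) : Set (V ≃ₗ[ℝ] V))
  have hO : O.Finite := by
    have hfin : (Set.pi Set.univ fun _ : Fin m => insert 0 T).Finite :=
      Set.Finite.pi fun _ => hT.insert 0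
    apply (hfin.image fun g : Fin m → V => f (∑ i ∈ L, u i • g i)).subset
    rintro _ ⟨w, hw, rfl⟩
    refine ⟨fun i => if i ∈ L then w (S.root i) else 0, ?_, ?_⟩
    · intro i _
      by_cases hi : i ∈ L
      · simp only [hi, if_true]; exact Or.inr (hwT w hw i hi)
      · simp only [hi, if_false]; exact Or.inl rfl
    · simp only [x, map_sum, map_smul]
      apply Finset.sum_congr rfl
      intro i hi
      simp [hi]
  have hne : O.Nonempty := ⟨_, 1, one_mem _, rfl⟩
  obtain ⟨_, ⟨w, hw, rfl⟩, hmax⟩ := Set.exists_max_image O id hO hne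
  refine ⟨w, hw, ?_⟩
  intro i hi
  have h1 := hmax _ ⟨w * S.s i, mul_mem hw (S.s_mem (show i ∈ (L : Set (Fin m)) from hi)), rfl⟩
  simp only [id, LinearEquiv.mul_apply, s_apply, map_sub, map_smul, smul_eq_mul] at h1
  have h2 := hcx i hi
  by_contra h3
  push Not at h3
  nlinarith

end Fin

end GCMRealization

namespace GCMRealization

section Ex

variable {m : ℕ} {V : Type*} [NormedAddCommGroup V] [NormedSpace ℝ V]
variable (S : GCMRealization m V)

theorem exists_rho : ∃ ρ : V, ∀ i, S.coroot i ρ = 1 := by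
  classical
  let Φ : V →ₗ[ℝ] (Fin m → ℝ) := LinearMap.pi S.coroot
  have hsurj : LinearMap.range Φ = ⊤ := by
    by_contra h
    obtain ⟨f, hf, hle⟩ := Submodule.exists_le_ker_of_lt_top _ (lt_top_iff_ne_top.2 h)
    apply hf
    have h0 : ∑ i, f (Pi.single i 1) • S.coroot i = 0 := by
      ext v
      have h1 : f (Φ v) = 0 := hle ⟨v, rfl⟩
      have h2 : Φ v = ∑ i, (S.coroot i v) • (Pi.single i 1 : Fin m → ℝ) := by
        ext j
        simp [Φ, Finset.sum_apply, Pi.single_apply]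
      rw [h2, map_sum] at h1
      simp only [map_smul, smul_eq_mul] at h1
      simp only [LinearMap.sum_apply, LinearMap.smul_apply, smul_eq_mul, LinearMap.zero_apply]
      rw [← h1]
      exact Finset.sum_congr rfl fun i _ => mul_comm _ _
    have h1 := Fintype.linearIndependent_iff.1 S.coroot_indep _ h0
    apply LinearMap.pi_ext'
    intro i
    ext
    simpa using h1 i
  have : (fun _ => 1 : Fin m → ℝ) ∈ LinearMap.range Φ := by rw [hsurj]; trivial
  obtain ⟨ρ, hρ⟩ := this
  exact ⟨ρ, fun i => congrFun hρ i⟩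

theorem comp_subset (J : Set (Fin m)) (i : Fin m) : S.comp J i ⊆ J := by
  rintro j ⟨_, hj, _⟩
  exact hj

theorem comp_not_adj {J : Set (Fin m)} {i j k : Fin m} (hj : j ∈ S.comp J i) (hk : k ∈ J)
    (hk' : k ∉ S.comp J i) : S.coroot k (S.root j) = 0 := by
  by_contra h
  obtain ⟨hi, hj', hr⟩ := hj
  apply hk'
  refine ⟨hi, hk, hr.trans ?_⟩
  apply SimpleGraph.Adj.reachable
  have h1 : S.A k j ≠ 0 := by
    intro h0
    apply h
    rw [S.pairing, h0]; simp
  refine ⟨?_, fun h0 => h1 ((S.A_zero_iff j k).1 h0), h1⟩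
  intro e
  apply hk'
  change j = k at e
  rw [← e]
  exact ⟨hi, hj', hr⟩

theorem exists_e_comp {J : Set (Fin m)} {i0 : Fin m} (hfin : S.FiniteType (S.comp J i0)) :
    ∃ x ∈ S.coneNonneg (S.comp J i0), (∀ i ∈ S.comp J i0, S.coroot i x = 1) ∧
      ∀ i ∈ J, 0 ≤ S.coroot i x := by
  classical
  set C := S.comp J i0 with hC
  obtain ⟨ρ, hρ⟩ := S.exists_rho
  have : Fintype (S.WI C) := Set.Finite.fintype hfin
  let N : ℝ := Fintype.card (S.WI C)
  have hN : 0 < N := by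
    have : 0 < Fintype.card (S.WI C) := Fintype.card_pos
    exact Nat.cast_pos.2 this
  let ρ0 : V := ∑ w : S.WI C, (w : V ≃ₗ[ℝ] V) ρ
  have hinv : ∀ i ∈ C, S.s i ρ0 = ρ0 := by
    intro i hi
    simp only [ρ0, map_sum]
    exact Fintype.sum_equiv (Equiv.mulLeft (⟨S.s i, S.s_mem hi⟩ : S.WI C)) _ _
      (fun w => by simp [LinearEquiv.mul_apply])
  have hco : ∀ i ∈ C, S.coroot i ρ0 = 0 := by
    intro i hi
    have h1 := hinv i hi
    rw [s_apply, sub_eq_self] at h1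
    have h2 := congrArg (S.coroot i) h1
    rw [map_smul, co_self, map_zero, smul_eq_mul] at h2
    linarith
  have hmem : (1 / N) • (∑ w : S.WI C, (ρ - (w : V ≃ₗ[ℝ] V) ρ)) ∈ S.coneNonneg C := by
    apply S.coneNonneg_smul _ (by positivity)
    have : ∀ s : Finset (S.WI C), ∑ w ∈ s, (ρ - (w : V ≃ₗ[ℝ] V) ρ) ∈ S.coneNonneg C := by
      intro s
      induction s using Finset.induction_on with
      | empty => simpa using S.coneNonneg_zero C
      | insert a s ha ih =>
        rw [Finset.sum_insert ha]
        exact S.coneNonneg_add (S.dominance (fun i _ => by rw [hρ]; norm_num) a a.2) ih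
    exact this _
  have hone : ∀ i ∈ C, S.coroot i ((1 / N) • (∑ w : S.WI C, (ρ - (w : V ≃ₗ[ℝ] V) ρ))) = 1 := by
    intro i hi
    rw [Finset.sum_sub_distrib, map_smul, map_sub, hco i hi]
    simp only [Finset.sum_const, Finset.card_univ, sub_zero, map_nsmul, hρ]
    simp only [nsmul_eq_mul, mul_one, smul_eq_mul]
    exact one_div_mul_cancel hN.ne'
  refine ⟨_, hmem, hone, ?_⟩
  intro i hi
  by_cases hiC : i ∈ C
  · rw [hone i hiC]; norm_num
  · obtain ⟨c, h1, h2, h3⟩ := hmem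
    rw [h3, map_sum]
    apply Finset.sum_nonneg
    intro j _
    by_cases hj : j ∈ C
    · rw [map_smul, S.comp_not_adj hj hi hiC]; simp
    · rw [h2 j hj]; simp

theorem exists_e {J : Set (Fin m)} (hfin : S.FinTypeComponents J) :
    ∃ e : Fin m → ℝ, (∀ i, 0 ≤ e i) ∧ (∀ i, i ∉ J → e i = 0) ∧
      ∀ i ∈ J, 0 < ∑ j, S.coroot i (S.root j) * e j := by
  classical
  have h : ∀ i0 : Fin m, ∃ x : V, x ∈ S.coneNonneg J ∧ (i0 ∈ J → 0 < S.coroot i0 x) ∧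
      ∀ i ∈ J, 0 ≤ S.coroot i x := by
    intro i0
    by_cases hi : i0 ∈ J
    · obtain ⟨x, ⟨c, hc1, hc2, hc3⟩, h2, h3⟩ := S.exists_e_comp (hfin i0 hi)
      refine ⟨x, ⟨c, hc1, fun i h => hc2 i (fun h' => h (S.comp_subset _ _ h')), hc3⟩, ?_, h3⟩
      intro _
      rw [h2 i0 ⟨hi, hi, SimpleGraph.Reachable.refl _⟩]
      norm_num
    · exact ⟨0, S.coneNonneg_zero _, fun h => absurd h hi, by simp⟩
  choose x hx1 hx2 hx3 using h
  have hmem : ∀ s : Finset (Fin m), ∑ i ∈ s, x i ∈ S.coneNonneg J := by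
    intro s
    induction s using Finset.induction_on with
    | empty => simpa using S.coneNonneg_zero J
    | insert a s ha ih =>
      rw [Finset.sum_insert ha]
      exact S.coneNonneg_add (hx1 a) ih
  obtain ⟨e, h1, h2, h3⟩ := hmem Finset.univ
  refine ⟨e, h1, h2, ?_⟩
  intro i hi
  have h4 : S.coroot i (∑ i, x i) = ∑ j, S.coroot i (S.root j) * e j := by
    rw [h3, map_sum]
    exact Finset.sum_congr rfl fun j _ => by rw [map_smul, smul_eq_mul, mul_comm]
  rw [← h4, map_sum]
  exact Finset.sum_pos' (fun j _ => hx3 j i hi) ⟨i, Finset.mem_univ _, hx2 i hi⟩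

end Ex

end GCMRealization

namespace GCMRealization

section Lem

variable {m : ℕ} {V : Type*} [NormedAddCommGroup V] [NormedSpace ℝ V]
variable (S : GCMRealization m V)

theorem WI_mono {K I : Set (Fin m)} (h : K ⊆ I) : S.WI K ≤ S.WI I :=
  Subgroup.closure_mono (Set.image_mono h)

theorem WI_fix {L : Set (Fin m)} {v : V} (h : ∀ i ∈ L, S.coroot i v = 0) :
    ∀ w ∈ S.WI L, w v = v := by
  refine S.WI_left_induction (P := fun w => w v = v) rfl ?_
  intro i hi w hw hP
  rw [LinearEquiv.mul_apply, hP, s_apply, h i hi, zero_smul, sub_zero]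

theorem WI_inv_fun {K : Set (Fin m)} {g : V →ₗ[ℝ] ℝ} (h : ∀ i ∈ K, g (S.root i) = 0) (v : V) :
    ∀ w ∈ S.WI K, g (w v) = g v := by
  refine S.WI_left_induction (P := fun w => g (w v) = g v) rfl ?_
  intro i hi w hw hP
  rw [LinearEquiv.mul_apply, s_apply, map_sub, map_smul, h i hi, hP]
  simp

theorem zero_of_comp_zero {K : Set (Fin m)} {f : V →ₗ[ℝ] ℝ} {w : V ≃ₗ[ℝ] V} (hw : w ∈ S.WI K)
    (h : ∀ i ∈ K, f (w (S.root i)) = 0) : ∀ i ∈ K, f (S.root i) = 0 := by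
  intro i hi
  have h1 := S.WI_inv_fun (g := f ∘ₗ w.toLinearMap) (fun i hi => h i hi) (w⁻¹ (S.root i)) w hw
  have h2 : w (w⁻¹ (S.root i)) = S.root i := by
    rw [← LinearEquiv.mul_apply, mul_inv_cancel]; rfl
  simp only [LinearMap.comp_apply, LinearEquiv.coe_coe, h2] at h1
  rw [← h1]
  exact h i hi

theorem co_sum (c : Fin m → ℝ) (i : Fin m) :
    S.coroot i (∑ j, c j • S.root j) = ∑ j, S.coroot i (S.root j) * c j := by
  rw [map_sum]
  exact Finset.sum_congr rfl fun j _ => by rw [map_smul, smul_eq_mul, mul_comm]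

theorem sum_L_ge {L : Finset (Fin m)} {c : Fin m → ℝ} (hc : ∀ i, 0 ≤ c i) {i : Fin m}
    (hi : i ∈ L) : ∑ j, S.coroot i (S.root j) * c j ≤ ∑ j ∈ L, S.coroot i (S.root j) * c j := by
  classical
  rw [← Finset.sum_sdiff (Finset.subset_univ L)]
  have : ∑ j ∈ Finset.univ \ L, S.coroot i (S.root j) * c j ≤ 0 := by
    apply Finset.sum_nonpos
    intro j hj
    have hj' : j ∉ L := by simpa using hj
    have : i ≠ j := by rintro rfl; exact hj' hi
    exact mul_nonpos_of_nonpos_of_nonneg (S.co_offdiag this) (hc j)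
  linarith

/-- Data for the main argument. -/
structure Setup (μ : V) (c e : Fin m → ℝ) (K : Set (Fin m)) : Prop where
  hμ : ∀ i, 0 ≤ S.coroot i μ
  hc : ∀ i, 0 ≤ c i
  hcK : ∀ i ∈ K, 0 < c i
  hc0 : ∀ i, i ∉ K → c i = 0
  he : ∀ i, 0 ≤ e i
  hJ : ∀ i ∈ K, S.coroot i μ = 0 → 0 < ∑ j, S.coroot i (S.root j) * e j
  hη : ∀ i, 0 ≤ S.coroot i (μ - ∑ j, c j • S.root j)

variable {S}
variable {μ : V} {c e : Fin m → ℝ} {K : Set (Fin m)}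

theorem Setup.dom (D : S.Setup μ c e K) {t : ℝ} (ht : 0 ≤ t) {L : Finset (Fin m)}
    (hLK : ∀ i ∈ L, i ∈ K) (hL : ∀ i ∈ L, S.coroot i (μ - t • ∑ j, c j • S.root j) = 0)
    (f : V →ₗ[ℝ] ℝ) : ∃ w ∈ S.WI (L : Set (Fin m)), ∀ i ∈ L, 0 ≤ f (w (S.root i)) := by
  classical
  have hP : ∀ i ∈ L, S.coroot i μ ≤ ∑ j ∈ L, S.coroot i (S.root j) * (t * c j) := by
    intro i hi
    have h1 := hL i hi
    rw [map_sub, map_smul, co_sum, smul_eq_mul, Finset.mul_sum] at h1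
    have h2 := S.sum_L_ge (c := fun j => t * c j) (fun j => mul_nonneg ht (D.hc j)) hi
    have h3 : ∑ j, t * (S.coroot i (S.root j) * c j) = ∑ j, S.coroot i (S.root j) * (t * c j) :=
      Finset.sum_congr rfl fun j _ => by ring
    linarith
  have hQ : ∀ i ∈ L, S.coroot i μ = 0 → 0 < ∑ j ∈ L, S.coroot i (S.root j) * e j := by
    intro i hi h0
    exact (D.hJ i (hLK i hi) h0).trans_le (S.sum_L_ge D.he hi)
  have hepos : ∀ i ∈ L, S.coroot i μ = 0 → 0 < e i := by
    intro i hi h0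
    by_contra h
    have h1 : e i = 0 := le_antisymm (not_lt.1 h) (D.he i)
    have h2 := hQ i hi h0
    have : ∑ j ∈ L, S.coroot i (S.root j) * e j ≤ 0 := by
      apply Finset.sum_nonpos
      intro j hj
      by_cases hij : i = j
      · subst hij; simp [h1]
      · exact mul_nonpos_of_nonpos_of_nonneg (S.co_offdiag hij) (D.he j)
    linarith
  have hev : ∀ᶠ ε : ℝ in nhdsWithin 0 (Set.Ioi 0), ∀ i ∈ L,
      0 < ∑ j ∈ L, S.coroot i (S.root j) * (t * c j) +
        ε * ∑ j ∈ L, S.coroot i (S.root j) * e j := by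
    rw [Filter.eventually_all_finset]
    intro i hi
    rcases (D.hμ i).eq_or_lt with h0 | h0
    · filter_upwards [self_mem_nhdsWithin] with ε hε
      have h1 := hP i hi
      have h2 := mul_pos (show 0 < ε from hε) (hQ i hi h0.symm)
      linarith
    · have hcont : Continuous fun ε : ℝ => ∑ j ∈ L, S.coroot i (S.root j) * (t * c j) +
        ε * ∑ j ∈ L, S.coroot i (S.root j) * e j := by fun_prop
      apply nhdsWithin_le_nhds
      apply hcont.continuousAt.eventually (lt_mem_nhds _)
      have h1 := hP i hi
      simp only [zero_mul, add_zero]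
      linarith
  obtain ⟨ε, h1, hε⟩ := (hev.and self_mem_nhdsWithin).exists
  have hε : 0 < ε := hε
  apply S.make_dominant (u := fun i => t * c i + ε * e i)
  · intro i hi
    rcases (D.hμ i).eq_or_lt with h0 | h0
    · have := mul_pos hε (hepos i hi h0.symm)
      have := mul_nonneg ht (D.hc i)
      linarith
    · have htpos : 0 < t := by
        rcases ht.eq_or_lt with rfl | h
        · have := hP i hi
          simp at this
          linarith
        · exact h
      have := mul_pos htpos (D.hcK i (hLK i hi))
      have := mul_nonneg hε.le (D.he i)
      linarith
  · intro i hi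
    have h2 := h1 i hi
    rw [Finset.mul_sum, ← Finset.sum_add_distrib] at h2
    convert h2 using 1
    exact Finset.sum_congr rfl fun j _ => by ring

theorem Setup.zero_of_sum (D : S.Setup μ c e K) {g : V →ₗ[ℝ] ℝ} (h : ∀ i ∈ K, 0 ≤ g (S.root i))
    (hs : g (∑ j, c j • S.root j) ≤ 0) : ∀ i ∈ K, g (S.root i) = 0 := by
  intro i hi
  rw [map_sum] at hs
  have hnn : ∀ j ∈ Finset.univ, 0 ≤ g (c j • S.root j) := by
    intro j _
    rw [map_smul, smul_eq_mul]
    by_cases hj : j ∈ K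
    · exact mul_nonneg (D.hc j) (h j hj)
    · rw [D.hc0 j hj, zero_mul]
  have h0 := (Finset.sum_eq_zero_iff_of_nonneg hnn).1 (le_antisymm hs (Finset.sum_nonneg hnn)) i
    (Finset.mem_univ _)
  rw [map_smul, smul_eq_mul] at h0
  exact (mul_eq_zero.1 h0).resolve_left (D.hcK i hi).ne'

theorem Setup.nonneg_cone {g : V →ₗ[ℝ] ℝ} {L : Set (Fin m)} (h : ∀ i ∈ L, 0 ≤ g (S.root i)) {v : V}
    (hv : v ∈ S.coneNonneg L) : 0 ≤ g v := by
  obtain ⟨a, h1, h2, rfl⟩ := hv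
  rw [map_sum]
  apply Finset.sum_nonneg
  intro j _
  rw [map_smul, smul_eq_mul]
  by_cases hj : j ∈ L
  · exact mul_nonneg (h1 j) (h j hj)
  · rw [h2 j hj, zero_mul]

theorem Setup.lemmaA (D : S.Setup μ c e K) {f : V →ₗ[ℝ] ℝ}
    (hf : ∀ w ∈ S.WI K, f (w μ) ≤ f μ) (hx : f (∑ j, c j • S.root j) ≤ 0) :
    ∀ i ∈ K, f (S.root i) = 0 := by
  classical
  let L : Finset (Fin m) := Finset.univ.filter fun i => i ∈ K ∧ S.coroot i μ = 0
  have hLK : (L : Set (Fin m)) ⊆ K := by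
    intro i hi
    simp [L] at hi
    exact hi.1
  have hL0 : ∀ i ∈ L, S.coroot i μ = 0 := by
    intro i hi
    simp [L] at hi
    exact hi.2
  obtain ⟨w, hw, hwL⟩ := D.dom (t := 0) le_rfl (L := L) hLK
    (by intro i hi; rw [zero_smul, sub_zero]; exact hL0 i hi) f
  have hwK := S.WI_mono hLK hw
  have hwμ : w μ = μ := S.WI_fix (fun i hi => hL0 i hi) w hw
  have hnn : ∀ i ∈ K, 0 ≤ f (w (S.root i)) := by
    intro i hi
    by_cases h0 : S.coroot i μ = 0
    · exact hwL i (by simp [L, hi, h0])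
    · have hpos : 0 < S.coroot i μ := lt_of_le_of_ne (D.hμ i) (Ne.symm h0)
      have h1 := hf (w * S.s i) (mul_mem hwK (S.s_mem hi))
      rw [LinearEquiv.mul_apply, s_apply, map_sub, map_smul, hwμ, map_sub, map_smul,
        smul_eq_mul] at h1
      by_contra h2
      push Not at h2
      nlinarith
  apply S.zero_of_comp_zero hwK
  apply D.zero_of_sum (g := f ∘ₗ w.toLinearMap) hnn
  have hdom := S.dominance (I := (L : Set (Fin m))) (v := -∑ j, c j • S.root j) (by
    intro i hi
    have h1 := D.hη i
    rw [map_sub, hL0 i hi] at h1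
    rw [map_neg]; linarith) w⁻¹ (inv_mem hw)
  have h2 := Setup.nonneg_cone (g := f ∘ₗ w.toLinearMap) (fun i hi => hwL i hi) hdom
  have h3 : w (w⁻¹ (∑ j, c j • S.root j)) = ∑ j, c j • S.root j := by
    rw [← LinearEquiv.mul_apply, mul_inv_cancel]; rfl
  rw [map_neg, sub_neg_eq_add, map_add, map_neg] at h2
  simp only [LinearMap.comp_apply, LinearEquiv.coe_coe, h3] at h2 ⊢
  linarith

theorem Setup.lemmaB (D : S.Setup μ c e K) {f : V →ₗ[ℝ] ℝ} {t : ℝ} (ht : 0 < t) (ht1 : t ≤ 1)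
    (hf : ∀ w ∈ S.WI K, f (w μ) ≤ f (μ - t • ∑ j, c j • S.root j))
    (hf2 : ∀ w ∈ S.WI K, f (w (μ - t • ∑ j, c j • S.root j)) ≤ f (μ - t • ∑ j, c j • S.root j)) :
    ∀ i ∈ K, f (S.root i) = 0 := by
  classical
  set η := μ - t • ∑ j, c j • S.root j with hηdef
  have hη : ∀ i, 0 ≤ S.coroot i η := by
    intro i
    have h1 := D.hη i
    have h2 := D.hμ i
    rw [map_sub] at h1
    rw [hηdef, map_sub, map_smul, smul_eq_mul]
    nlinarith
  let L : Finset (Fin m) := Finset.univ.filter fun i => i ∈ K ∧ S.coroot i η = 0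
  have hLK : (L : Set (Fin m)) ⊆ K := by
    intro i hi
    simp [L] at hi
    exact hi.1
  have hL0 : ∀ i ∈ L, S.coroot i η = 0 := by
    intro i hi
    simp [L] at hi
    exact hi.2
  obtain ⟨w, hw, hwL⟩ := D.dom ht.le (L := L) hLK hL0 f
  have hwK := S.WI_mono hLK hw
  have hwη : w η = η := S.WI_fix (fun i hi => hL0 i hi) w hw
  have hnn : ∀ i ∈ K, 0 ≤ f (w (S.root i)) := by
    intro i hi
    by_cases h0 : S.coroot i η = 0
    · exact hwL i (by simp [L, hi, h0])
    · have hpos : 0 < S.coroot i η := lt_of_le_of_ne (hη i) (Ne.symm h0)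
      have h1 := hf2 (w * S.s i) (mul_mem hwK (S.s_mem hi))
      rw [LinearEquiv.mul_apply, s_apply, map_sub, map_smul, hwη, map_sub, map_smul,
        smul_eq_mul] at h1
      by_contra h2
      push Not at h2
      nlinarith
  apply S.zero_of_comp_zero hwK
  apply D.zero_of_sum (g := f ∘ₗ w.toLinearMap) hnn
  have h1 := hf w hwK
  have h2 : f η = f (w μ) - t * f (w (∑ j, c j • S.root j)) := by
    rw [← hwη, hηdef, map_sub, map_smul, map_sub, map_smul, smul_eq_mul]
  simp only [LinearMap.comp_apply, LinearEquiv.coe_coe]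
  by_contra h3
  push Not at h3
  have := mul_pos ht h3
  linarith

end Lem

end GCMRealization

section Topo

variable {E : Type*} [NormedAddCommGroup E] [NormedSpace ℝ E] [FiniteDimensional ℝ E]

theorem topo_interior_nonempty {H : Set E} (hH : Convex ℝ H) (h0 : (0 : E) ∈ H) (c : E)
    (hA : ∀ F : E →L[ℝ] ℝ, (∀ h ∈ H, 0 ≤ F h) → F c ≤ 0 → F = 0) : (interior H).Nonempty := by
  rw [hH.interior_nonempty_iff_affineSpan_eq_top]
  by_contra hne
  have hspan : Submodule.span ℝ H < ⊤ := by
    rw [lt_top_iff_ne_top]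
    intro h
    apply hne
    have h1 := affineSpan_insert_zero (k := ℝ) H
    rw [Set.insert_eq_of_mem h0, h] at h1
    apply SetLike.coe_injective
    rw [h1]
    simp
  obtain ⟨f, hf, hle⟩ := Submodule.exists_le_ker_of_lt_top _ hspan
  let F : E →L[ℝ] ℝ := LinearMap.toContinuousLinearMap f
  have hF : ∀ h ∈ H, F h = 0 := fun h hh => hle (Submodule.subset_span hh)
  have hF0 : F = 0 := by
    rcases le_total (F c) 0 with hc | hc
    · exact hA F (fun h hh => (hF h hh).ge) hc
    · exact neg_eq_zero.1 (hA (-F) (fun h hh => by simp [hF h hh]) (by simpa using hc))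
  apply hf
  ext v
  exact congrArg (fun G : E →L[ℝ] ℝ => G v) hF0

theorem topo_start {H : Set E} (hH : Convex ℝ H) (h0 : (0 : E) ∈ H) (c : E)
    (hA : ∀ F : E →L[ℝ] ℝ, (∀ h ∈ H, 0 ≤ F h) → F c ≤ 0 → F = 0) :
    ∃ t : ℝ, 0 < t ∧ t ≤ 1 ∧ t • c ∈ interior H := by
  have hne := topo_interior_nonempty hH h0 c hA
  let U : Set E := {y | ∃ s : ℝ, 0 < s ∧ s • y ∈ interior H}
  have hUopen : IsOpen U := by
    have : U = ⋃ s ∈ Set.Ioi (0 : ℝ), (fun y : E => s • y) ⁻¹' interior H := by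
      ext y; simp [U]
    rw [this]
    exact isOpen_biUnion fun s _ => isOpen_interior.preimage (continuous_const_smul s)
  have hUconv : Convex ℝ U := by
    rintro y1 ⟨s1, hs1, h1⟩ y2 ⟨s2, hs2, h2⟩ a b ha hb hab
    have hd : 0 < a * s2 + b * s1 := by
      rcases ha.eq_or_lt with rfl | ha'
      · have : b = 1 := by linarith
        subst this; linarith
      · have := mul_pos ha' hs2
        have := mul_nonneg hb hs1.le
        linarith
    refine ⟨s1 * s2 / (a * s2 + b * s1), by positivity, ?_⟩
    have h3 := hH.interior h1 h2 (a := a * s2 / (a * s2 + b * s1))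
      (b := b * s1 / (a * s2 + b * s1)) (by positivity) (by positivity)
      (by rw [← add_div, div_self hd.ne'])
    convert h3 using 1
    rw [smul_add, smul_smul, smul_smul, smul_smul, smul_smul]
    congr 2 <;> ring
  have hUscale : ∀ u ∈ U, ∀ r : ℝ, 0 < r → r • u ∈ U := by
    rintro u ⟨s, hs, h⟩ r hr
    refine ⟨s / r, by positivity, ?_⟩
    rwa [smul_smul, div_mul_cancel₀ _ hr.ne']
  have hiU : interior H ⊆ U := fun y hy => ⟨1, one_pos, by simpa using hy⟩
  have hcU : c ∈ U := by
    by_contra hcU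
    obtain ⟨F, hF⟩ := geometric_hahn_banach_open_point hUconv hUopen hcU
    have hle : ∀ u ∈ U, F u ≤ 0 := by
      intro u hu
      by_contra h
      push Not at h
      have h1 := hF _ (hUscale u hu ((|F c| + 1) / F u) (by positivity))
      rw [map_smul, smul_eq_mul, div_mul_cancel₀ _ h.ne'] at h1
      have := le_abs_self (F c)
      linarith
    obtain ⟨p, hp⟩ := hne
    have hFc : 0 ≤ F c := by
      by_contra h
      push Not at h
      have hp0 := hF p (hiU hp)
      have hpn : F p < 0 := by linarith
      have h1 := hF _ (hUscale p (hiU hp) (F c / F p / 2)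
        (by have := div_pos_of_neg_of_neg h hpn; positivity))
      rw [map_smul, smul_eq_mul] at h1
      have : F c / F p / 2 * F p = F c / 2 := by
        rw [div_right_comm, div_mul_cancel₀ _ hpn.ne]
      linarith
    have hH0 : ∀ h ∈ H, 0 ≤ (-F) h := by
      intro h hh
      have h1 : h ∈ closure (interior H) := by
        rw [hH.closure_interior_eq_closure_of_nonempty_interior ⟨p, hp⟩]
        exact subset_closure hh
      have hcl : IsClosed {y : E | 0 ≤ (-F) y} := isClosed_le continuous_const (-F).continuous
      exact closure_minimal (fun y hy => by simpa using hle y (hiU hy)) hcl h1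
    have hz := hA (-F) hH0 (by simpa using hFc)
    have hz' : F = 0 := neg_eq_zero.1 hz
    have := hF p (hiU hp)
    simp [hz'] at this
  obtain ⟨s, hs, hsc⟩ := hcU
  rcases le_total s 1 with h | h
  · exact ⟨s, hs, h, hsc⟩
  · refine ⟨1, one_pos, le_rfl, ?_⟩
    have h1 := hH.combo_interior_self_mem_interior hsc h0 (a := 1 / s) (b := 1 - 1 / s)
      (by positivity) (by rw [sub_nonneg, div_le_one hs]; exact h) (by ring)
    rwa [smul_zero, add_zero, smul_smul, one_div_mul_cancel hs.ne'] at h1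

theorem topo_main {H : Set E} (hH : Convex ℝ H) (h0 : (0 : E) ∈ H) (c : E)
    (hA : ∀ F : E →L[ℝ] ℝ, (∀ h ∈ H, 0 ≤ F h) → F c ≤ 0 → F = 0)
    (hB : ∀ F : E →L[ℝ] ℝ, ∀ t : ℝ, 0 < t → t ≤ 1 → t • c ∈ closure H →
      (∀ h ∈ H, F (t • c) ≤ F h) → F = 0) : c ∈ H := by
  obtain ⟨t0, ht0, ht01, hint0⟩ := topo_start hH h0 c hA
  have hup : ∀ t : ℝ, 0 < t → t ≤ 1 → t • c ∈ closure H → t • c ∈ interior H := by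
    intro t ht ht1 hcl
    by_contra hn
    obtain ⟨F, hF⟩ := geometric_hahn_banach_open_point hH.interior isOpen_interior hn
    have hz := hB (-F) t ht ht1 hcl (by
      intro h hh
      have h1 : h ∈ closure (interior H) := by
        rw [hH.closure_interior_eq_closure_of_nonempty_interior ⟨_, hint0⟩]
        exact subset_closure hh
      have hc : IsClosed {y : E | (-F) (t • c) ≤ (-F) y} :=
        isClosed_le continuous_const (-F).continuous
      exact closure_minimal (fun y hy => by simpa using (hF y hy).le) hc h1)
    have hz' : F = 0 := neg_eq_zero.1 hz
    have := hF _ hint0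
    simp [hz'] at this
  have hcont : Continuous fun t : ℝ => t • c := continuous_id.smul continuous_const
  have hfin : (1 : ℝ) ∈ {t : ℝ | t • c ∈ closure H} := by
    apply IsClosed.mem_of_ge_of_forall_exists_gt (a := t0)
    · exact (isClosed_closure.preimage hcont).inter isClosed_Icc
    · exact subset_closure (interior_subset hint0)
    · exact ht01
    · rintro t ⟨hts, ht1, ht2⟩
      have h1 := hup t (ht0.trans_le ht1) ht2.le hts
      have h2 : ∀ᶠ r in nhdsWithin t (Set.Ioi t), r • c ∈ interior H :=
        nhdsWithin_le_nhds (hcont.continuousAt.eventually (isOpen_interior.mem_nhds h1))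
      have h3 : ∀ᶠ r in nhdsWithin t (Set.Ioi t), r ∈ Set.Ioc t 1 := Ioc_mem_nhdsGT ht2
      obtain ⟨r, hr1, hr2⟩ := (h2.and h3).exists
      exact ⟨r, subset_closure (interior_subset hr1), hr2⟩
  have := interior_subset (hup 1 one_pos le_rfl hfin)
  simpa using this

end Topo

namespace GCMRealization

section Final

variable {m : ℕ} {V : Type*} [NormedAddCommGroup V] [NormedSpace ℝ V]
variable (S : GCMRealization m V)

theorem mem_orbitOf {G : Subgroup (V ≃ₗ[ℝ] V)} {w : V ≃ₗ[ℝ] V} (hw : w ∈ G) (μ : V) :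
    w μ ∈ orbitOf G μ := ⟨w, hw, rfl⟩

theorem face_invariant {μ : V} {K : Set (Fin m)} {w : V ≃ₗ[ℝ] V} (hw : w ∈ S.WI K) {y : V}
    (hy : y ∈ S.face μ K) : w y ∈ S.face μ K := by
  have h1 : S.face μ K ⊆ w.toLinearMap ⁻¹' (S.face μ K) := by
    apply convexHull_min
    · rintro _ ⟨v, hv, rfl⟩
      exact subset_convexHull ℝ _ ⟨w * v, mul_mem hw hv, rfl⟩
    · exact (convex_convexHull ℝ _).linear_preimage w.toLinearMap
  exact h1 hy

theorem face_subset {μ : V} (hμ : ∀ i, 0 ≤ S.coroot i μ) (I : Set (Fin m)) :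
    S.face μ I ⊆ (fun v => μ - v) '' S.coneNonneg I := by
  apply convexHull_min
  · rintro _ ⟨w, hw, rfl⟩
    exact ⟨_, S.dominance (fun i _ => hμ i) w hw, by simp⟩
  · rintro _ ⟨x, hx, rfl⟩ _ ⟨y, hy, rfl⟩ a b ha hb hab
    refine ⟨a • x + b • y, S.coneNonneg_add (S.coneNonneg_smul hx ha) (S.coneNonneg_smul hy hb), ?_⟩
    have : μ = a • μ + b • μ := by rw [← add_smul, hab, one_smul]
    simp only [smul_sub]
    nth_rewrite 1 [this]
    abel

variable {S}
variable {μ : V} {c e : Fin m → ℝ} {K : Set (Fin m)}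

theorem Setup.main (D : S.Setup μ c e K) : μ - ∑ j, c j • S.root j ∈ S.face μ K := by
  classical
  have := S.finDim
  let Φ : (K → ℝ) →ₗ[ℝ] V := Fintype.linearCombination ℝ (fun i : K => S.root i)
  have hΦ : ∀ a, Φ a = ∑ i : K, a i • S.root i := fun a => rfl
  have hΦinj : LinearMap.ker Φ = ⊥ := by
    have hli : LinearIndependent ℝ (fun i : K => S.root i) :=
      S.root_indep.comp _ Subtype.val_injective
    rw [LinearMap.ker_eq_bot']
    intro a ha
    ext i
    exact Fintype.linearIndependent_iff.1 hli a ha i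
  obtain ⟨Ψ, hΨ⟩ := LinearMap.exists_leftInverse_of_injective Φ hΦinj
  have hΦc : ∀ d : Fin m → ℝ, (∀ i, i ∉ K → d i = 0) →
      Φ (fun i : K => d i) = ∑ j, d j • S.root j := by
    intro d hd
    rw [hΦ]
    rw [← Finset.sum_subtype (Finset.univ.filter fun i => i ∈ K) (p := fun i => i ∈ K)
      (by simp) (fun j => d j • S.root j)]
    apply Finset.sum_subset (Finset.subset_univ _)
    intro j _ hj
    rw [hd j (by simpa using hj), zero_smul]
  let c' : K → ℝ := fun i => c i
  have hc' : Φ c' = ∑ j, c j • S.root j := hΦc c D.hc0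
  let H : Set (K → ℝ) := {a | μ - Φ a ∈ S.face μ K}
  have hrep : ∀ y ∈ S.face μ K, ∃ a ∈ H, y = μ - Φ a := by
    intro y hy
    obtain ⟨x, ⟨d, _, hd, rfl⟩, rfl⟩ := S.face_subset D.hμ K hy
    refine ⟨fun i : K => d i, ?_, ?_⟩
    · simp only [H, Set.mem_ofPred_eq, hΦc d hd]; exact hy
    · rw [hΦc d hd]
  have hμH : μ ∈ S.face μ K := subset_convexHull ℝ _ ⟨1, one_mem _, rfl⟩
  have hH : Convex ℝ H := by
    intro a ha b hb p q hp hq hpq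
    have h1 := convex_convexHull ℝ _ ha hb hp hq hpq
    have h2 : μ - Φ (p • a + q • b) = p • (μ - Φ a) + q • (μ - Φ b) := by
      have : μ = p • μ + q • μ := by rw [← add_smul, hpq, one_smul]
      simp only [smul_sub, map_add, map_smul]
      nth_rewrite 1 [this]
      abel
    simp only [H, Set.mem_ofPred_eq, h2]
    exact h1
  have h0 : (0 : K → ℝ) ∈ H := by simp only [H, Set.mem_ofPred_eq, map_zero, sub_zero]; exact hμH
  have hext : ∀ F : (K → ℝ) →L[ℝ] ℝ, ∃ f : V →ₗ[ℝ] ℝ, (∀ a, f (Φ a) = F a) ∧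
      ((∀ i ∈ K, f (S.root i) = 0) → F = 0) := by
    intro F
    refine ⟨F.toLinearMap ∘ₗ Ψ, ?_, ?_⟩
    · intro a
      have := LinearMap.congr_fun hΨ a
      simp only [LinearMap.comp_apply, LinearMap.id_apply] at this
      simp [this]
    · intro h
      ext a
      have h1 := LinearMap.congr_fun hΨ a
      simp only [LinearMap.comp_apply, LinearMap.id_apply] at h1
      have h2 : (F.toLinearMap ∘ₗ Ψ) (Φ a) = F a := by simp [h1]
      rw [← h2, hΦ, map_sum]
      simp only [zero_apply]
      apply Finset.sum_eq_zero
      intro i _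
      rw [map_smul, h i i.2, smul_zero]
  have hmem : c' ∈ H := by
    apply topo_main hH h0
    · intro F hF hFc
      obtain ⟨f, hf, hf0⟩ := hext F
      apply hf0
      apply D.lemmaA
      · intro w hw
        obtain ⟨a, ha, hwa⟩ := hrep (w μ) (subset_convexHull ℝ _ ⟨w, hw, rfl⟩)
        rw [hwa, map_sub, hf]
        have := hF a ha
        linarith
      · rw [← hc', hf]; exact hFc
    · intro F t ht ht1 hcl hF
      obtain ⟨f, hf, hf0⟩ := hext F
      apply hf0
      have hηt : μ - t • ∑ j, c j • S.root j = μ - Φ (t • c') := by rw [map_smul, hc']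
      have hHle : ∀ y ∈ S.face μ K, f y ≤ f (μ - Φ (t • c')) := by
        intro y hy
        obtain ⟨a, ha, rfl⟩ := hrep y hy
        rw [map_sub, map_sub, hf, hf]
        have := hF a ha
        linarith
      apply D.lemmaB ht ht1
      · intro w hw
        rw [hηt]
        exact hHle _ (subset_convexHull ℝ _ ⟨w, hw, rfl⟩)
      · intro w hw
        rw [hηt]
        have hcont : Continuous fun a : K → ℝ => f (w (μ - Φ a)) := by
          have h1 : Continuous fun a : K → ℝ => Φ a := Φ.continuous_of_finiteDimensional
          have h2 : Continuous fun v : V => f (w v) :=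
            (f ∘ₗ w.toLinearMap).continuous_of_finiteDimensional
          exact h2.comp (continuous_const.sub h1)
        have hclosed : IsClosed {a : K → ℝ | f (w (μ - Φ a)) ≤ f (μ - Φ (t • c'))} :=
          isClosed_le hcont continuous_const
        have hsub : H ⊆ {a : K → ℝ | f (w (μ - Φ a)) ≤ f (μ - Φ (t • c'))} :=
          fun a ha => hHle _ (S.face_invariant hw ha)
        exact closure_minimal hsub hclosed hcl
  have h1 : μ - Φ c' ∈ S.face μ K := hmem
  rwa [hc'] at h1

end Final

end GCMRealization

open GCMRealization in
theorem statement_9 {m : ℕ} {V : Type*} [NormedAddCommGroup V] [NormedSpace ℝ V]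
    (S : GCMRealization m V) (μ : V) (hμ : μ ∈ S.chamber)
    (I : Set (Fin m)) (hcon : S.MuConnected μ I)
    (hfin : S.FinTypeComponents (I ∩ S.J0 μ)) :
    S.face μ I ∩ S.chamber = ((fun v => μ - v) '' S.coneNonneg I) ∩ S.chamber ∧
    S.face μ I ∩ S.chamber =
      ((fun v => μ - v) '' S.coneNonneg I) ∩ S.closedFacet (S.starSet μ I) := by
  have h1 : S.face μ I ∩ S.chamber = ((fun v => μ - v) '' S.coneNonneg I) ∩ S.chamber := by
    apply Set.Subset.antisymm
    · exact Set.inter_subset_inter_left _ (S.face_subset hμ I)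
    · rintro _ ⟨⟨_, ⟨c, hc, hcI, rfl⟩, rfl⟩, hch⟩
      refine ⟨?_, hch⟩
      obtain ⟨e, he, he0, heJ⟩ := S.exists_e hfin
      have hKI : {i | c i ≠ 0} ⊆ I := by
        intro i hi
        by_contra h
        exact hi (hcI i h)
      have D : S.Setup μ c e {i | c i ≠ 0} :=
        { hμ := hμ
          hc := hc
          hcK := fun i hi => lt_of_le_of_ne (hc i) (Ne.symm hi)
          hc0 := fun i hi => by simpa using hi
          he := he
          hJ := fun i hi h0 => heJ i ⟨hKI hi, h0⟩
          hη := hch }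
      exact convexHull_mono (Set.image_mono (S.WI_mono hKI)) D.main
  refine ⟨h1, h1.trans ?_⟩
  apply Set.Subset.antisymm
  · rintro _ ⟨⟨_, ⟨c, hc, hcI, rfl⟩, rfl⟩, hch⟩
    refine ⟨⟨_, ⟨c, hc, hcI, rfl⟩, rfl⟩, ?_, fun i _ => hch i⟩
    rintro i ⟨hi0, hiI, hi⟩
    simp only [map_sub, hi0, map_sum, map_smul, smul_eq_mul, zero_sub, neg_eq_zero]
    apply Finset.sum_eq_zero
    intro j _
    by_cases hj : j ∈ I
    · rw [hi j hj, mul_zero]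
    · rw [hcI j hj, zero_mul]
  · rintro _ ⟨hm, hz, hp⟩
    refine ⟨hm, fun i => ?_⟩
    by_cases hi : i ∈ S.starSet μ I
    · exact (hz i hi).ge
    · exact hp i hi
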